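/- arXiv:2207.01215 — 2 statements merged into one kernel-verified Lean document; each statement's English description precedes it below -/
import Mathlib

section
/- Let A ≤ S_m, B ≤ S_n, and let b ∈ B have exactly ℓ cycles in its disjoint cycle decomposition (fixed points counted as 1-cycles). Consider the coset A^{[n]}b = {(α,b) : α : [n] → A} inside A≀_P B acting on [m]^{[n]}. Then for every k ≥ 0, δ_k(A^{[n]}b) = ∑_{(j_1,…,j_ℓ) nonneg integers, j_1⋯j_ℓ=k} ∏_{r=1}^{ℓ} δ_{j_r}(A); in particular, δ(A^{[n]}b) = 1 − (1−δ(A))^ℓ. -/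
open Equiv Finset

/-- The number of fixed points of a permutation. -/
noncomputable def fixCnt {X : Type*} (g : Equiv.Perm X) : ℕ := {x | g x = x}.ncard

/-- The proportion of elements `a` of the set `C` such that the permutation `f a`
has exactly `k` fixed points. -/
noncomputable def propFixVia {α X : Type*} (f : α → Equiv.Perm X) (C : Set α) (k : ℕ) : ℝ :=
  (({a ∈ C | fixCnt (f a) = k}).ncard : ℝ) / (C.ncard : ℝ)

/-- `δ_k(C)`: the proportion of elements of `C ⊆ Sym(X)` with exactly `k` fixed points. -/
noncomputable def propFix {X : Type*} (C : Set (Equiv.Perm X)) (k : ℕ) : ℝ :=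
  propFixVia id C k

/-- The element `(α, b)` of the wreath product acting on `X × Y` via the imprimitive
action `(x, y) ↦ (x α(y), y b)`. -/
def imprimPerm {X Y : Type*} (α : Y → Equiv.Perm X) (b : Equiv.Perm Y) :
    Equiv.Perm (X × Y) where
  toFun p := (α p.2 p.1, b p.2)
  invFun p := ((α (b⁻¹ p.2))⁻¹ p.1, b⁻¹ p.2)
  left_inv p := by simp
  right_inv p := by simp

/-- The element `(α, b)` of the wreath product acting on `X^Y` via the power action
`(ω(α,b))(y) = ω(y b⁻¹) α(y b⁻¹)`. -/
def powerPerm {X Y : Type*} (α : Y → Equiv.Perm X) (b : Equiv.Perm Y) :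
    Equiv.Perm (Y → X) where
  toFun ω y := α (b⁻¹ y) (ω (b⁻¹ y))
  invFun ω y := (α y)⁻¹ (ω (b y))
  left_inv ω := by funext y; simp
  right_inv ω := by funext y; simp

/-- The number of cycles of a permutation in its disjoint cycle decomposition,
where fixed points are counted as 1-cycles. -/
noncomputable def cycleCnt {Y : Type*} [Fintype Y] [DecidableEq Y] (b : Equiv.Perm Y) : ℕ :=
  b.cycleType.card + fixCnt b

/-- The underlying set of the wreath product `A ≀ B` (pairs `(α, b)`). -/
def wreathSet {m n : ℕ} (A : Subgroup (Equiv.Perm (Fin m))) (B : Subgroup (Equiv.Perm (Fin n))) :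
    Set ((Fin n → Equiv.Perm (Fin m)) × Equiv.Perm (Fin n)) :=
  {p | (∀ y, p.1 y ∈ A) ∧ p.2 ∈ B}

/-- `δ_k(A ≀_I B)` for the imprimitive action on `[m] × [n]`. -/
noncomputable def deltaI {m n : ℕ} (A : Subgroup (Equiv.Perm (Fin m)))
    (B : Subgroup (Equiv.Perm (Fin n))) (k : ℕ) : ℝ :=
  propFixVia (fun p => imprimPerm p.1 p.2) (wreathSet A B) k

/-- `δ_k(A ≀_P B)` for the power action on `[m]^[n]`. -/
noncomputable def deltaP {m n : ℕ} (A : Subgroup (Equiv.Perm (Fin m)))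
    (B : Subgroup (Equiv.Perm (Fin n))) (k : ℕ) : ℝ :=
  propFixVia (fun p => powerPerm p.1 p.2) (wreathSet A B) k

/-- `[B, ℓ]`: the number of elements of `B` with exactly `ℓ` cycles. -/
noncomputable def stirCnt {n : ℕ} (B : Subgroup (Equiv.Perm (Fin n))) (ℓ : ℕ) : ℕ :=
  {b ∈ (B : Set (Equiv.Perm (Fin n))) | cycleCnt b = ℓ}.ncard

/-- A subgroup `A ≤ Sym(X)` is primitive if it is transitive and every block is trivial
(equivalently, it preserves no nontrivial partition of `X`). -/
def IsPrimitiveSubgroup {X : Type*} (A : Subgroup (Equiv.Perm X)) : Prop :=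
  MulAction.IsPretransitive A X ∧
  ∀ s : Set X, MulAction.IsBlock A s → s.Subsingleton ∨ s = Set.univ


/-- `r` selects one representative from each cycle of `b`. -/
structure IsCycleRep {Y : Type*} (b : Equiv.Perm Y) (r : Y → Y) : Prop where
  sameCycle : ∀ y, b.SameCycle (r y) y
  eq_of_sameCycle : ∀ {x y}, b.SameCycle x y → r x = r y

namespace IsCycleRep

variable {Y : Type*} {b : Equiv.Perm Y} {r : Y → Y}

theorem exists_rep (b : Equiv.Perm Y) : ∃ r, IsCycleRep b r :=
  ⟨fun y => (Quotient.mk (Equiv.Perm.SameCycle.setoid b) y).out,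
    fun _ => Quotient.exact (s := Equiv.Perm.SameCycle.setoid b) (Quotient.out_eq _),
    fun {_ _} h => congrArg Quotient.out (Quotient.sound (s := Equiv.Perm.SameCycle.setoid b) h)⟩

theorem idem (hr : IsCycleRep b r) (y : Y) : r (r y) = r y :=
  hr.eq_of_sameCycle (hr.sameCycle y)

theorem apply_perm (hr : IsCycleRep b r) (y : Y) : r (b y) = r y :=
  hr.eq_of_sameCycle (Equiv.Perm.sameCycle_apply_left.2 (Equiv.Perm.SameCycle.refl b y))

/-- To prove a property of all points, start at the representatives and move along the cycles. -/
theorem induction_on [Finite Y] (hr : IsCycleRep b r) {p : Y → Prop}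
    (rep : ∀ y, r y = y → p y) (step : ∀ y, p y → p (b y)) (y : Y) : p y := by
  obtain ⟨i, -, hi⟩ := (hr.sameCycle y).exists_pow_eq'
  rw [← hi]
  clear hi
  induction i with
  | zero => exact rep _ (hr.idem y)
  | succ i ih => rw [pow_succ', Equiv.Perm.mul_apply]; exact step _ ih

theorem card_rep [Fintype Y] [DecidableEq Y] (hr : IsCycleRep b r) :
    Fintype.card {y // r y = y} = cycleCnt b := by
  have hfix : ∀ y, b y = y → r y = y := fun y hy =>
    ((hr.sameCycle y).symm.eq_of_left hy).symm
  have hcycle : #{y | r y = y ∧ b y ≠ y} = #b.cycleFactorsFinset := by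
    refine Finset.card_bij (fun y _ => b.cycleOf y) ?_ ?_ ?_
    · intro y hy
      simp only [Finset.mem_filter, Finset.mem_univ, true_and] at hy
      exact Equiv.Perm.cycleOf_mem_cycleFactorsFinset_iff.2 (Equiv.Perm.mem_support.2 hy.2)
    · intro x hx y hy hxy
      simp only [Finset.mem_filter, Finset.mem_univ, true_and] at hx hy
      have h := (Equiv.Perm.sameCycle_iff_cycleOf_eq_of_mem_support
        (Equiv.Perm.mem_support.2 hx.2) (Equiv.Perm.mem_support.2 hy.2)).2 hxy
      rw [← hx.1, ← hy.1, hr.eq_of_sameCycle h]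
    · intro c hc
      obtain ⟨y, hy⟩ := (Equiv.Perm.mem_cycleFactorsFinset_iff.1 hc).1.nonempty_support
      have hcy := Equiv.Perm.cycle_is_cycleOf hy hc
      have hby : y ∈ b.support := Equiv.Perm.mem_cycleFactorsFinset_support_le hc hy
      refine ⟨r y, ?_, ?_⟩
      · simp only [Finset.mem_filter, Finset.mem_univ, true_and]
        exact ⟨hr.idem y, Equiv.Perm.mem_support.1 ((hr.sameCycle y).mem_support_iff.2 hby)⟩
      · rw [hcy, (hr.sameCycle y).cycleOf_eq]
  have hfixed : #{y | r y = y ∧ ¬ b y ≠ y} = fixCnt b := by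
    rw [fixCnt, ← Set.ncard_coe_finset]
    congr 1
    ext y
    simpa using hfix y
  rw [cycleCnt, Equiv.Perm.cycleType_def, Multiset.card_map, ← hfixed, Finset.card_val, ← hcycle,
    Fintype.card_subtype, ← Finset.card_filter_add_card_filter_not (fun y => b y ≠ y),
    Finset.filter_filter, Finset.filter_filter]

end IsCycleRep

theorem powerPerm_eq_self_iff {X Y : Type*} {α : Y → Equiv.Perm X} {b : Equiv.Perm Y} {ω : Y → X} :
    powerPerm α b ω = ω ↔ ∀ y, α y (ω y) = ω (b y) := by
  constructor
  · intro h y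
    simpa [powerPerm] using congrFun h (b y)
  · intro h
    funext y
    simpa [powerPerm] using h (b⁻¹ y)

theorem coe_congr {X Y : Type*} {p : Y → Prop} {s : {y // p y} → Set X} (x : ∀ y, s y)
    {y z : {y // p y}} (h : (y : Y) = z) : (x y : X) = x z := by
  obtain rfl := Subtype.ext h
  rfl

section Gauge

variable {X Y G : Type*} [Group G] [DecidableEq Y]

/-- The part of `g` away from the representatives selected by `r`. -/
def offRep (r : Y → Y) (g : Y → G) (y : Y) : G := if r y = y then 1 else g y

/-- The base-group component which has holonomy `g y` around the cycle with representative `y`,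
the other values of `g` being free parameters. -/
def cycleGauge (b : Equiv.Perm Y) (r : Y → Y) (g : Y → G) (y : Y) : G :=
  g (b y) * (offRep r g y)⁻¹

theorem cycleGauge_bijective [Finite Y] [Finite G] {b : Equiv.Perm Y} {r : Y → Y}
    (hr : IsCycleRep b r) : Function.Bijective (cycleGauge b r : (Y → G) → Y → G) := by
  rw [← Finite.injective_iff_bijective]
  intro g g' h
  have hstep : ∀ y, offRep r g y = offRep r g' y → g (b y) = g' (b y) := by
    intro y hy
    have := congrFun h y
    simp only [cycleGauge, hy] at this
    exact mul_right_cancel this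
  have hoff : ∀ y, offRep r g y = offRep r g' y := by
    refine hr.induction_on ?_ ?_
    · intro y hy
      simp [offRep, hy]
    · intro y hy
      simp only [offRep, hstep y hy]
  funext y
  simpa using hstep (b⁻¹ y) (hoff _)

/-- Fixed points of a gauged element are determined by their values at the representatives. -/
def fixedPointsEquiv [Finite Y] {b : Equiv.Perm Y} {r : Y → Y} (hr : IsCycleRep b r)
    (g : Y → Equiv.Perm X) :
    {ω | powerPerm (cycleGauge b r g) b ω = ω} ≃ ∀ y : {y // r y = y}, {x | g y x = x} where
  toFun ω y := ⟨ω.1 y, by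
    have hω := powerPerm_eq_self_iff.1 ω.2
    have hconst : ∀ z, (offRep r g z)⁻¹ (ω.1 z) = ω.1 (r z) := by
      refine hr.induction_on ?_ ?_
      · intro z hz
        simp [offRep, hz]
      · intro z hz
        by_cases hbz : r (b z) = b z
        · simp [offRep, hbz]
        · rw [hr.apply_perm, ← hz, ← hω z, cycleGauge, offRep, if_neg hbz]
          simp
    have h := hω (b⁻¹ y)
    rw [cycleGauge, Equiv.Perm.mul_apply, hconst, ← hr.apply_perm] at h
    simpa [y.2] using h⟩
  invFun x := ⟨fun y => offRep r g y (x ⟨r y, hr.idem y⟩), powerPerm_eq_self_iff.2 fun y => by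
    have hx : x ⟨r (b y), hr.idem _⟩ = (x ⟨r y, hr.idem y⟩ : X) :=
      coe_congr x (hr.apply_perm y)
    rw [hx]
    by_cases hy : r (b y) = b y
    · have := (x ⟨b y, hy⟩).2
      have hx' : (x ⟨b y, hy⟩ : X) = x ⟨r y, hr.idem y⟩ :=
        coe_congr x (hy.symm.trans (hr.apply_perm y))
      rw [hx'] at this
      simpa [cycleGauge, offRep, hy] using this
    · simp [cycleGauge, offRep, hy]⟩
  left_inv ω := by
    have hω := powerPerm_eq_self_iff.1 ω.2
    ext y
    revert y
    refine hr.induction_on ?_ ?_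
    · intro y hy
      simp [offRep, hy]
    · intro y hy
      by_cases hby : r (b y) = b y
      · simp [offRep, hby]
      · rw [← hω y, ← hy]
        simp only [cycleGauge, offRep, if_neg hby]
        simp [hr.apply_perm]
  right_inv x := by
    funext y
    ext
    simpa [offRep, y.2] using coe_congr x y.2

theorem fixCnt_powerPerm_cycleGauge [Fintype Y] {b : Equiv.Perm Y} {r : Y → Y} (hr : IsCycleRep b r)
    (g : Y → Equiv.Perm X) :
    fixCnt (powerPerm (cycleGauge b r g) b) = ∏ y : {y // r y = y}, fixCnt (g y) := by
  simp only [fixCnt, ← Nat.card_coe_set_eq]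
  rw [Nat.card_congr (fixedPointsEquiv hr g), Nat.card_pi]

end Gauge

section Count

variable {X Y : Type*} [Fintype Y] [DecidableEq Y]

theorem propFix_eq_card_div (A : Subgroup (Equiv.Perm X)) [Fintype A] (k : ℕ) :
    propFix (A : Set (Equiv.Perm X)) k =
      #{a : A | fixCnt (a : Equiv.Perm X) = k} / (Fintype.card A : ℝ) := by
  rw [propFix, propFixVia, ← Nat.card_coe_set_eq (A : Set (Equiv.Perm X)),
    ← Nat.card_eq_fintype_card, ← Set.ncard_coe_finset,
    ← Set.ncard_image_of_injective _ (Subtype.val_injective (p := (· ∈ A)))]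
  congr 3
  ext a
  simp [and_comm]

theorem propFixVia_powerPerm_eq_card_div (A : Subgroup (Equiv.Perm X)) [Fintype A]
    (b : Equiv.Perm Y) (k : ℕ) :
    propFixVia (fun α : Y → Equiv.Perm X => powerPerm α b) {α | ∀ y, α y ∈ A} k =
      #{α : Y → A | fixCnt (powerPerm (fun y => (α y : Equiv.Perm X)) b) = k} /
        (Fintype.card A : ℝ) ^ Fintype.card Y := by
  have hinj : Function.Injective (fun (α : Y → A) y => (α y : Equiv.Perm X)) :=
    Subtype.val_injective.comp_left
  have hcount (p : (Y → Equiv.Perm X) → Prop) [DecidablePred p] :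
      {α ∈ {α : Y → Equiv.Perm X | ∀ y, α y ∈ A} | p α}.ncard =
        #{α : Y → A | p fun y => α y} := by
    rw [← Set.ncard_coe_finset, ← Set.ncard_image_of_injective _ hinj]
    congr 1
    ext α
    constructor
    · rintro ⟨hα, hp⟩
      exact ⟨fun y => ⟨α y, hα y⟩, by simpa using hp, rfl⟩
    · rintro ⟨α, hp, rfl⟩
      exact ⟨fun y => (α y).2, by simpa using hp⟩
  have htotal : {α : Y → Equiv.Perm X | ∀ y, α y ∈ A}.ncard =
      Fintype.card A ^ Fintype.card Y := by
    simpa using hcount fun _ => True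
  rw [propFixVia, hcount, htotal, Nat.cast_pow]

theorem card_rep_fixCnt_eq (A : Subgroup (Equiv.Perm X)) [Fintype A] (r : Y → Y)
    (j : {y // r y = y} → ℕ) :
    (#{g : Y → A | ∀ y : {y // r y = y}, fixCnt (g y : Equiv.Perm X) = j y} : ℝ) /
        (Fintype.card A : ℝ) ^ Fintype.card Y =
      ∏ y, propFix (A : Set (Equiv.Perm X)) (j y) := by
  classical
  have hset : ({g : Y → A | ∀ y : {y // r y = y}, fixCnt (g y : Equiv.Perm X) = j y} : Finset _) =
      Fintype.piFinset fun y => ({a : A | ∀ h : r y = y, fixCnt (a : Equiv.Perm X) = j ⟨y, h⟩} :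
        Finset A) := by
    ext g
    simp
  have hA : (Fintype.card A : ℝ) ≠ 0 := Nat.cast_ne_zero.2 Fintype.card_ne_zero
  rw [hset, Fintype.card_piFinset, Nat.cast_prod, ← Finset.card_univ (α := Y), ← Finset.prod_const,
    ← Finset.prod_div_distrib, ← Fintype.prod_subtype_mul_prod_subtype (fun y => r y = y)]
  rw [Finset.prod_congr rfl (g := fun y => propFix (A : Set (Equiv.Perm X)) (j y)),
    Finset.prod_eq_one (s := (Finset.univ : Finset {y // ¬ r y = y})), mul_one]
  · rintro ⟨y, hy⟩ -
    simp [hy, hA]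
  · rintro ⟨y, hy⟩ -
    simp [hy, propFix_eq_card_div]

variable [Finite X]

theorem fixCnt_mem_range (g : Equiv.Perm X) : fixCnt g ∈ Finset.range (Nat.card X + 1) :=
  Finset.mem_range_succ_iff.2 (Set.ncard_le_card _)

theorem sum_propFix (A : Subgroup (Equiv.Perm X)) :
    ∑ k ∈ Finset.range (Nat.card X + 1), propFix (A : Set (Equiv.Perm X)) k = 1 := by
  have := Fintype.ofFinite A
  simp_rw [propFix_eq_card_div]
  rw [← Finset.sum_div, ← Nat.cast_sum,
    ← Finset.card_eq_sum_card_fiberwise (f := fun a : A => fixCnt (a : Equiv.Perm X))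
      fun a _ => fixCnt_mem_range (a : Equiv.Perm X),
    Finset.card_univ]
  exact div_self (Nat.cast_ne_zero.2 Fintype.card_ne_zero)

theorem propFixVia_powerPerm_eq_sum (A : Subgroup (Equiv.Perm X)) (b : Equiv.Perm Y) (k : ℕ) :
    propFixVia (fun α : Y → Equiv.Perm X => powerPerm α b) {α | ∀ y, α y ∈ A} k =
      ∑ j ∈ (Fintype.piFinset fun _ : Fin (cycleCnt b) =>
          Finset.range (Nat.card X + 1)).filter (fun j => (∏ i, j i) = k),
        ∏ i, propFix (A : Set (Equiv.Perm X)) (j i) := by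
  classical
  have := Fintype.ofFinite A
  obtain ⟨r, hr⟩ := IsCycleRep.exists_rep b
  let e : Fin (cycleCnt b) ≃ {y // r y = y} := (Fintype.equivFinOfCardEq hr.card_rep).symm
  have hfix (g : Y → A) : fixCnt (powerPerm (fun y => ((cycleGauge b r g y : A) : Equiv.Perm X)) b) =
      ∏ i, fixCnt (g (e i) : Equiv.Perm X) := by
    have hval : (fun y => ((cycleGauge b r g y : A) : Equiv.Perm X)) =
        cycleGauge b r fun y => (g y : Equiv.Perm X) := by
      funext y
      simp only [cycleGauge, offRep]
      split <;> simp
    rw [hval, fixCnt_powerPerm_cycleGauge hr,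
      ← e.prod_comp fun y => fixCnt (g y : Equiv.Perm X)]
  have hgauge : #{α : Y → A | fixCnt (powerPerm (fun y => (α y : Equiv.Perm X)) b) = k} =
      #{g : Y → A | ∏ i, fixCnt (g (e i) : Equiv.Perm X) = k} := by
    refine (Finset.card_bijective (cycleGauge b r) (cycleGauge_bijective hr) fun g => ?_).symm
    simp only [Finset.mem_filter, Finset.mem_univ, true_and, hfix]
  rw [propFixVia_powerPerm_eq_card_div, hgauge, Finset.card_eq_sum_card_fiberwise
    (f := fun g i => fixCnt (g (e i) : Equiv.Perm X))
    (t := (Fintype.piFinset fun _ : Fin (cycleCnt b) =>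
      Finset.range (Nat.card X + 1)).filter fun j => (∏ i, j i) = k), Nat.cast_sum, Finset.sum_div]
  · refine Finset.sum_congr rfl fun j hj => ?_
    have hcard := card_rep_fixCnt_eq A r (j ∘ e.symm)
    rw [← e.prod_comp] at hcard
    simp only [Function.comp_apply, Equiv.symm_apply_apply] at hcard
    rw [← hcard]
    congr 3
    ext g
    simp only [Finset.mem_filter, Finset.mem_univ, true_and, funext_iff, ← e.forall_congr_right,
      Equiv.symm_apply_apply]
    refine and_iff_right_of_imp fun h => ?_
    simp_rw [h]
    exact (Finset.mem_filter.1 hj).2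
  · intro g hg
    simp only [Finset.coe_filter, Finset.mem_univ, true_and, Set.mem_ofPred_eq] at hg ⊢
    exact ⟨Fintype.mem_piFinset.2 fun i => fixCnt_mem_range _, hg⟩

end Count

/-- The contribution of the tuples with a zero entry to a power of a sum equal to `1`. -/
theorem sum_piFinset_prod_eq_zero (δ : ℕ → ℝ) (m ℓ : ℕ)
    (hδ : ∑ k ∈ Finset.range (m + 1), δ k = 1) :
    ∑ j ∈ (Fintype.piFinset fun _ : Fin ℓ => Finset.range (m + 1)).filter
        (fun j => (∏ i, j i) = 0), ∏ i, δ (j i) = 1 - (1 - δ 0) ^ ℓ := by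
  have htotal := (Finset.sum_pow' (Finset.range (m + 1)) δ ℓ).symm
  have hpos := (Finset.sum_pow' ((Finset.range (m + 1)).erase 0) δ ℓ).symm
  rw [hδ, one_pow] at htotal
  have herase : ∑ k ∈ (Finset.range (m + 1)).erase 0, δ k = 1 - δ 0 := by
    rw [Finset.sum_erase_eq_sub (by simp), hδ]
  rw [herase] at hpos
  rw [← Finset.sum_filter_add_sum_filter_not _ fun j => (∏ i, j i) = 0] at htotal
  rw [← hpos, eq_sub_iff_add_eq, ← htotal]
  congr 2
  ext j
  simp [Finset.prod_eq_zero_iff, forall_and, and_comm]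

/-- **Theorem (power action on a coset `A^{[n]} b`).**
If `b ∈ B ≤ S_n` has exactly `ℓ` cycles, then for every `k`,
`δ_k(A^{[n]} b) = ∑_{j₁⋯j_ℓ = k} ∏_{r=1}^ℓ δ_{j_r}(A)` (the sum ranges over all
tuples of nonnegative integers with product `k`; terms with some `j_r > m` vanish
since `δ_j(A) = 0` for `j > m`), and in particular
`δ(A^{[n]} b) = 1 - (1 - δ(A))^ℓ`. -/
theorem deltaK_coset_power_action (m n : ℕ)
    (A : Subgroup (Equiv.Perm (Fin m))) (B : Subgroup (Equiv.Perm (Fin n)))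
    (b : Equiv.Perm (Fin n)) (hb : b ∈ B) (ℓ : ℕ) (hℓ : cycleCnt b = ℓ) :
    (∀ k : ℕ,
      propFixVia (fun α : Fin n → Equiv.Perm (Fin m) => powerPerm α b)
          {α | ∀ y, α y ∈ A} k =
        ∑ j ∈ (Fintype.piFinset fun _ : Fin ℓ => Finset.range (m + 1)).filter
            (fun j => (∏ r : Fin ℓ, j r) = k),
          ∏ r : Fin ℓ, propFix (A : Set (Equiv.Perm (Fin m))) (j r)) ∧
    propFixVia (fun α : Fin n → Equiv.Perm (Fin m) => powerPerm α b)
        {α | ∀ y, α y ∈ A} 0 =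
      1 - (1 - propFix (A : Set (Equiv.Perm (Fin m))) 0) ^ ℓ := by
  subst hℓ
  have hm := propFixVia_powerPerm_eq_sum A b
  have hδ := sum_propFix A
  rw [Nat.card_fin] at hm hδ
  exact ⟨hm, (hm 0).trans (sum_piFinset_prod_eq_zero _ m _ hδ)⟩
end

section
/- Fix n ≥ 1 and a subgroup B ≤ S_n. The set of real numbers {δ(A≀_I B) : m ∈ ℕ, A ≤ S_m a primitive permutation group} is dense in the interval [δ(B), 1]. -/
open Equiv Finset

section FixedPoints

variable {α X Y : Type*}

lemma fixCnt_eq_zero_iff [Finite X] (g : Perm X) : fixCnt g = 0 ↔ ∀ x, g x ≠ x := by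
  rw [fixCnt, Set.ncard_eq_zero (Set.toFinite _), Set.eq_empty_iff_forall_notMem]
  rfl

lemma propFix_image {f : α → Perm X} {C : Set α} (hf : Set.InjOn f C) (k : ℕ) :
    propFix (f '' C) k = propFixVia f C k := by
  have h : {g ∈ f '' C | fixCnt (id g) = k} = f '' {a ∈ C | fixCnt (f a) = k} := by
    ext g
    simp only [Set.mem_ofPred_eq, Set.mem_image, id]
    constructor
    · rintro ⟨⟨a, ha, rfl⟩, hk⟩
      exact ⟨a, ⟨ha, hk⟩, rfl⟩
    · rintro ⟨a, ⟨ha, hk⟩, rfl⟩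
      exact ⟨⟨a, ha, rfl⟩, hk⟩
  rw [propFix, propFixVia, propFixVia, h, hf.ncard_image,
    (hf.mono fun _ ha => ha.1).ncard_image]

lemma propFixVia_mem_Icc [Finite α] (f : α → Perm X) (C : Set α) (k : ℕ) :
    propFixVia f C k ∈ Set.Icc (0 : ℝ) 1 := by
  refine ⟨by unfold propFixVia; positivity, div_le_one_of_le₀ ?_ (by positivity)⟩
  exact_mod_cast Set.ncard_le_ncard (Set.sep_subset C _) (Set.toFinite C)

lemma propFixVia_univ_zero [Fintype α] [Nonempty α] [Finite X] (f : α → Perm X)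
    [DecidablePred fun a => ∃ x, f a x = x] :
    propFixVia f Set.univ 0 =
      1 - (#{a | ∃ x, f a x = x} : ℝ) / Fintype.card α := by
  have h : {a ∈ (Set.univ : Set α) | fixCnt (f a) = 0} =
      (({a | ¬ ∃ x, f a x = x} : Finset α) : Set α) := by
    ext a
    simp [fixCnt_eq_zero_iff]
  have hc := Finset.card_filter_add_card_filter_not (s := (Finset.univ : Finset α))
    (fun a => ∃ x, f a x = x)
  have hpos : (0 : ℝ) < Fintype.card α := by exact_mod_cast Fintype.card_pos
  rw [propFixVia, h, Set.ncard_coe_finset, Set.ncard_univ, Nat.card_eq_fintype_card,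
    eq_sub_iff_add_eq, ← add_div, div_eq_one_iff_eq hpos.ne', add_comm]
  exact_mod_cast hc

lemma fixCnt_permCongr (e : X ≃ Y) (g : Perm X) : fixCnt (e.permCongr g) = fixCnt g := by
  have h : {y | e.permCongr g y = y} = e '' {x | g x = x} := by
    ext y
    simp [Equiv.permCongr_apply, Equiv.eq_symm_apply, Equiv.image_eq_preimage_symm]
  rw [fixCnt, fixCnt, h, Set.ncard_image_of_injective _ e.injective]

lemma propFix_map_permCongr (e : X ≃ Y) (A : Subgroup (Perm X)) (k : ℕ) :
    propFix (A.map e.permCongrHom.toMonoidHom : Set (Perm Y)) k = propFix (A : Set (Perm X)) k := by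
  rw [Subgroup.coe_map]
  refine (propFix_image (f := e.permCongrHom) e.permCongrHom.injective.injOn k).trans ?_
  simp only [propFix, propFixVia]
  congr 3
  ext g
  simp [fixCnt_permCongr]

end FixedPoints

section Blocks

variable {X Y : Type*}

/-- A set is a block as soon as every group element that maps some point of it into it
maps all of it into itself. -/
lemma isBlock_subgroup_iff (A : Subgroup (Perm X)) (s : Set X) :
    MulAction.IsBlock A s ↔ ∀ g ∈ A, ∀ x ∈ s, g x ∈ s → ∀ z ∈ s, g z ∈ s := by
  rw [MulAction.isBlock_iff_smul_eq_of_mem]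
  constructor
  · intro h g hg x hx hgx z hz
    have := h (g := ⟨g, hg⟩) hx hgx
    rw [← this]
    exact Set.smul_mem_smul_set hz
  · intro h g x hx hgx
    ext z
    rw [Set.mem_smul_set_iff_inv_smul_mem]
    constructor
    · intro hz
      have := h g.1 g.2 x hx hgx _ hz
      simpa [Subgroup.smul_def] using this
    · intro hz
      have := h g.1⁻¹ (A.inv_mem g.2) (g.1 x) hgx (by simpa using hx) z hz
      simpa [Subgroup.smul_def] using this

lemma isPretransitive_subgroup_iff (A : Subgroup (Perm X)) :
    MulAction.IsPretransitive A X ↔ ∀ x y : X, ∃ g ∈ A, g x = y := by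
  rw [MulAction.isPretransitive_iff]
  simp [Subgroup.smul_def]

lemma IsPrimitiveSubgroup.map_permCongr {A : Subgroup (Perm X)} (hA : IsPrimitiveSubgroup A)
    (e : X ≃ Y) : IsPrimitiveSubgroup (A.map e.permCongrHom.toMonoidHom) := by
  obtain ⟨htrans, hblock⟩ := hA
  rw [isPretransitive_subgroup_iff] at htrans
  constructor
  · rw [isPretransitive_subgroup_iff]
    intro x y
    obtain ⟨g, hg, hxy⟩ := htrans (e.symm x) (e.symm y)
    exact ⟨_, Subgroup.mem_map_of_mem _ hg, by simp [Equiv.permCongr_apply, hxy]⟩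
  · intro s hs
    rw [isBlock_subgroup_iff] at hs
    have : MulAction.IsBlock A (e ⁻¹' s) := by
      rw [isBlock_subgroup_iff]
      intro g hg x hx hgx z hz
      have := hs _ (Subgroup.mem_map_of_mem e.permCongrHom.toMonoidHom hg) (e x) hx
        (by simpa [Equiv.permCongr_apply] using hgx) (e z) hz
      simpa [Equiv.permCongr_apply] using this
    refine (hblock _ this).imp (fun h x hx y hy => ?_) fun h => ?_
    · exact e.symm.injective (h (by simpa using hx) (by simpa using hy))
    · rw [← Set.image_preimage_eq s e.surjective, h, Set.image_univ, e.range_eq_univ]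

/-- Point stabilizers of `A` fix no further point. -/
def StabilizersSeparate (A : Subgroup (Perm X)) : Prop :=
  ∀ x x' : X, x ≠ x' → ∃ a ∈ A, a x = x ∧ a x' ≠ x'

end Blocks

section PowerAction

variable {X Y : Type*}

lemma powerPerm_apply_apply (α : Y → Perm X) (b : Perm Y) (ω : Y → X) (y : Y) :
    powerPerm α b ω (b y) = α y (ω y) := by
  simp [powerPerm]

lemma powerPerm_mul (α β : Y → Perm X) (b c : Perm Y) :
    powerPerm α b * powerPerm β c = powerPerm (fun y => α (c y) * β y) (b * c) := by
  ext ω y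
  simp [powerPerm]

lemma powerPerm_one : powerPerm (1 : Y → Perm X) 1 = 1 := by
  ext ω y
  simp [powerPerm]

lemma powerPerm_inv (α : Y → Perm X) (b : Perm Y) :
    (powerPerm α b)⁻¹ = powerPerm (fun y => (α (b⁻¹ y))⁻¹) b⁻¹ := by
  rw [inv_eq_iff_mul_eq_one, powerPerm_mul, ← powerPerm_one]
  congr 1
  · ext y x
    simp
  · simp

lemma powerPerm_fixed_iff (α : Y → Perm X) (b : Perm Y) (ω : Y → X) :
    powerPerm α b ω = ω ↔ ∀ y, ω (b y) = α y (ω y) := by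
  rw [funext_iff, ← b.forall_congr_right]
  simp [powerPerm, eq_comm]

/-- The wreath product of `A` and `B` in its power action, as a permutation group. -/
def powerSubgroup (A : Subgroup (Perm X)) (B : Subgroup (Perm Y)) : Subgroup (Perm (Y → X)) where
  carrier := {g | ∃ α : Y → Perm X, ∃ b : Perm Y, (∀ y, α y ∈ A) ∧ b ∈ B ∧ powerPerm α b = g}
  one_mem' := ⟨1, 1, fun _ => A.one_mem, B.one_mem, powerPerm_one⟩
  mul_mem' := by
    rintro _ _ ⟨α, b, hα, hb, rfl⟩ ⟨β, c, hβ, hc, rfl⟩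
    exact ⟨_, _, fun y => A.mul_mem (hα _) (hβ y), B.mul_mem hb hc, (powerPerm_mul _ _ _ _).symm⟩
  inv_mem' := by
    rintro _ ⟨α, b, hα, hb, rfl⟩
    exact ⟨_, _, fun y => A.inv_mem (hα _), B.inv_mem hb, (powerPerm_inv _ _).symm⟩

lemma powerPerm_mem_powerSubgroup {A : Subgroup (Perm X)} {B : Subgroup (Perm Y)} {α : Y → Perm X}
    {b : Perm Y} (hα : ∀ y, α y ∈ A) (hb : b ∈ B) : powerPerm α b ∈ powerSubgroup A B :=
  ⟨α, b, hα, hb, rfl⟩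

/-- A permutation acting on a single coordinate. -/
lemma powerPerm_mulSingle [DecidableEq Y] (a : Perm X) (y : Y) (ω : Y → X) :
    powerPerm (Pi.mulSingle y a) 1 ω = Function.update ω y (a (ω y)) := by
  ext z
  rw [← Perm.one_apply z, powerPerm_apply_apply]
  rcases eq_or_ne z y with rfl | h
  · simp
  · simp [h]

lemma mulSingle_mem_subgroup [DecidableEq Y] {A : Subgroup (Perm X)} {a : Perm X} (ha : a ∈ A)
    (y z : Y) : (Pi.mulSingle y a : Y → Perm X) z ∈ A := by
  rcases eq_or_ne z y with rfl | h
  · simpa using ha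
  · simp [h, A.one_mem]

lemma StabilizersSeparate.powerSubgroup {A : Subgroup (Perm X)} (hA : StabilizersSeparate A)
    (B : Subgroup (Perm Y)) : StabilizersSeparate (powerSubgroup A B) := by
  classical
  intro ω ω' hne
  obtain ⟨y, hy⟩ := Function.ne_iff.mp hne
  obtain ⟨a, ha, hfix, hmove⟩ := hA _ _ hy
  refine ⟨_, powerPerm_mem_powerSubgroup (mulSingle_mem_subgroup ha y) B.one_mem, ?_, ?_⟩
  · rw [powerPerm_mulSingle, hfix, Function.update_eq_self]
  · rw [powerPerm_mulSingle]
    exact fun h => hmove (by simpa using congrFun h y)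

lemma eq_univ_of_update_mem [Finite Y] [DecidableEq Y] {s : Set (Y → X)} (hne : s.Nonempty)
    (hs : ∀ ω ∈ s, ∀ y x, Function.update ω y x ∈ s) : s = Set.univ := by
  cases nonempty_fintype Y
  obtain ⟨ω, hω⟩ := hne
  refine Set.eq_univ_of_forall fun η => ?_
  have key : ∀ t : Finset Y, t.piecewise η ω ∈ s := by
    intro t
    induction t using Finset.induction_on with
    | empty => simpa using hω
    | insert y t _ ih =>
      rw [Finset.piecewise_insert]
      exact hs _ ih _ _
  simpa using key Finset.univ

/-- The power action of a wreath product is primitive. -/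
lemma IsPrimitiveSubgroup.powerSubgroup [Finite Y] {A : Subgroup (Perm X)} {B : Subgroup (Perm Y)}
    (hA : IsPrimitiveSubgroup A) (hsep : StabilizersSeparate A)
    (hB : MulAction.IsPretransitive B Y) : IsPrimitiveSubgroup (powerSubgroup A B) := by
  classical
  obtain ⟨htrans, hblock⟩ := hA
  rw [isPretransitive_subgroup_iff] at htrans hB
  choose τ hτA hτ using htrans
  constructor
  · rw [isPretransitive_subgroup_iff]
    intro ω η
    refine ⟨_, powerPerm_mem_powerSubgroup (fun y => hτA (ω y) (η y)) B.one_mem, ?_⟩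
    ext y
    simp [powerPerm, hτ]
  intro s hs
  rw [isBlock_subgroup_iff] at hs
  rw [or_iff_not_imp_left, Set.not_subsingleton_iff]
  rintro ⟨ω, hω, ω', hω', hne⟩
  obtain ⟨y, hy⟩ := Function.ne_iff.mp hne
  obtain ⟨a, ha, hfix, hmove⟩ := hsep _ _ hy
  have single_mem : ∀ a ∈ A, powerPerm (Pi.mulSingle y a) 1 ∈ _root_.powerSubgroup A B :=
    fun a ha => powerPerm_mem_powerSubgroup (mulSingle_mem_subgroup ha y) B.one_mem
  have hω'' : Function.update ω' y (a (ω' y)) ∈ s := by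
    rw [← powerPerm_mulSingle]
    refine hs _ (single_mem a ha) ω hω ?_ ω' hω'
    rwa [powerPerm_mulSingle, hfix, Function.update_eq_self]
  have hline : ∀ x, Function.update ω' y x ∈ s := by
    have hT : MulAction.IsBlock A {x | Function.update ω' y x ∈ s} := by
      rw [isBlock_subgroup_iff]
      intro g hg x hx hgx z hz
      have := hs _ (single_mem g hg) _ hx (by simpa [powerPerm_mulSingle] using hgx) _ hz
      simpa [powerPerm_mulSingle] using this
    rcases hblock _ hT with h | h
    · exact absurd (h hω'' (by simpa using hω')) hmove
    · exact fun x => Set.eq_univ_iff_forall.mp h x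
  refine eq_univ_of_update_mem ⟨ω, hω⟩ fun η hη z x => ?_
  obtain ⟨b, hb, rfl⟩ := hB y z
  let α : Y → Perm X := fun y => τ (ω' y) (η (b y))
  have hα : powerPerm α b ω' = η := by
    ext z
    simp [powerPerm, α, hτ]
  have hmem := hs _ (powerPerm_mem_powerSubgroup (fun y => hτA _ _) hb) ω' hω' (hα.symm ▸ hη)
    _ (hline ((α y)⁻¹ x))
  convert hmem using 1
  ext w
  obtain ⟨v, rfl⟩ := b.surjective w
  rw [powerPerm_apply_apply]
  rcases eq_or_ne v y with rfl | h
  · simp [α]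
  · simp [h, hτ]

lemma powerPerm_injective [Nontrivial X] :
    Function.Injective fun q : (Y → Perm X) × Perm Y => powerPerm q.1 q.2 := by
  classical
  rintro ⟨α, b⟩ ⟨β, c⟩ h
  have happ : ∀ (ω : Y → X) (y : Y), α (b⁻¹ y) (ω (b⁻¹ y)) = β (c⁻¹ y) (ω (c⁻¹ y)) :=
    fun ω y => congrFun (DFunLike.congr_fun h ω) y
  have hbc : b = c := by
    rw [← inv_inj]
    ext y
    by_contra hne
    obtain ⟨x, x', hx⟩ := exists_pair_ne X
    have h1 := happ (fun _ => x) y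
    have h2 := happ (Function.update (fun _ => x) (b⁻¹ y) x') y
    simp only [Function.update_self, Function.update_of_ne (Ne.symm hne)] at h2
    exact hx ((α _).injective (h1.trans h2.symm))
  subst hbc
  refine Prod.ext (funext fun y => Equiv.ext fun x => ?_) rfl
  simpa using happ (fun _ => x) (b y)

end PowerAction

section CyclicPower

variable {X : Type*}

/-- The group of translations of an additive commutative group. -/
def translations (M : Type*) [AddCommGroup M] : Subgroup (Perm M) where
  carrier := Set.range Equiv.addRight
  one_mem' := ⟨0, by simp⟩
  mul_mem' := by
    rintro _ _ ⟨c, rfl⟩ ⟨d, rfl⟩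
    exact ⟨d + c, by ext; simp [add_assoc]⟩
  inv_mem' := by
    rintro _ ⟨c, rfl⟩
    exact ⟨-c, by ext; simp⟩

lemma isPretransitive_translations (M : Type*) [AddCommGroup M] :
    MulAction.IsPretransitive (translations M) M := by
  rw [isPretransitive_subgroup_iff]
  exact fun x y => ⟨_, ⟨y - x, rfl⟩, by simp⟩

variable {p : ℕ}

/-- The ordered product of the first `k` values of `α` met when walking from `0` in steps of `c`. -/
def walkProd {G : Type*} [Group G] (α : ZMod p → G) (c : ZMod p) : ℕ → G
  | 0 => 1
  | k + 1 => α (k * c) * walkProd α c k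

lemma walkProd_congr {G : Type*} [Group G] {α β : ZMod p → G} {c : ZMod p} {k : ℕ}
    (h : ∀ i < k, α (i * c) = β (i * c)) : walkProd α c k = walkProd β c k := by
  induction k with
  | zero => rfl
  | succ k ih =>
    rw [walkProd, walkProd, h k k.lt_succ_self, ih fun i hi => h i (hi.trans k.lt_succ_self)]

lemma walkProd_add_period {G : Type*} [Group G] (α : ZMod p → G) (c : ZMod p) (k : ℕ) :
    walkProd α c (k + p) = walkProd α c k * walkProd α c p := by
  induction k with
  | zero => simp [walkProd]
  | succ k ih =>
    rw [Nat.succ_add, walkProd, ih, walkProd, mul_assoc]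
    simp

variable [Fact p.Prime]

lemma exists_powerPerm_fixed_iff (A : Subgroup (Perm X)) (α : ZMod p → A) {c : ZMod p}
    (hc : c ≠ 0) : (∃ ω, powerPerm (fun y => (α y : Perm X)) (Equiv.addRight c) ω = ω) ↔
      ∃ x, (walkProd α c p).1 x = x := by
  simp only [powerPerm_fixed_iff, Equiv.coe_addRight]
  constructor
  · rintro ⟨ω, hω⟩
    have h : ∀ k : ℕ, ω (k * c) = (walkProd α c k).1 (ω 0) := by
      intro k
      induction k with
      | zero => simp [walkProd]
      | succ k ih => simp [walkProd, ← ih, ← hω, add_mul]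
    exact ⟨ω 0, by simpa using (h p).symm⟩
  · rintro ⟨x, hx⟩
    have hper : Function.Periodic (fun k => (walkProd α c k).1 x) p := by
      intro k
      simp [walkProd_add_period, hx]
    refine ⟨fun y => (walkProd α c (y / c).val).1 x, fun y => ?_⟩
    have h1 : ((y + c) / c).val = ((y / c).val + 1) % p := by
      rw [add_div, div_self hc, ZMod.val_add, ZMod.val_one]
    have h2 := hper.map_mod_nat ((y / c).val + 1)
    beta_reduce
    rw [h1, h2, walkProd]
    simp [div_mul_cancel₀ y hc]

/-- Absorbing all earlier factors of `walkProd α c p` into the value of `α` at `-c`. -/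
def absorbWalk {G : Type*} [Group G] (c : ZMod p) (hc : c ≠ 0) : (ZMod p → G) ≃ (ZMod p → G) :=
  have hcongr : ∀ (α : ZMod p → G) (g : G),
      walkProd (Function.update α (-c) g) c (p - 1) = walkProd α c (p - 1) := by
    intro α g
    refine walkProd_congr fun i hi => Function.update_of_ne (fun h => ?_) _ _
    have h0 : ((i + 1 : ℕ) : ZMod p) = 0 := by
      have : ((i : ZMod p) + 1) * c = 0 := by rw [add_mul, h]; ring
      simpa [hc] using this
    rw [ZMod.natCast_eq_zero_iff] at h0
    exact absurd (Nat.le_of_dvd i.succ_pos h0) (by omega)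
  { toFun := fun α => Function.update α (-c) (α (-c) * walkProd α c (p - 1))
    invFun := fun α => Function.update α (-c) (α (-c) * (walkProd α c (p - 1))⁻¹)
    left_inv := fun α => by simp [hcongr]
    right_inv := fun α => by simp [hcongr] }

lemma absorbWalk_apply_neg {G : Type*} [Group G] {c : ZMod p} (hc : c ≠ 0) (α : ZMod p → G) :
    absorbWalk c hc α (-c) = walkProd α c p := by
  have hp : p - 1 + 1 = p := Nat.sub_add_cancel (Fact.out : p.Prime).one_le
  have h : (((p - 1 : ℕ) : ZMod p)) * c = -c := by
    have : ((p - 1 : ℕ) : ZMod p) + 1 = 0 := by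
      rw [← Nat.cast_succ, Nat.succ_eq_add_one, hp, ZMod.natCast_self]
    rw [eq_neg_of_add_eq_zero_left this, neg_one_mul]
  have hlast : walkProd α c p = walkProd α c (p - 1 + 1) := congrArg _ hp.symm
  rw [hlast, walkProd, h]
  simp [absorbWalk]

lemma card_walkProd_mem {G : Type*} [Group G] [Fintype G] [DecidableEq G] {c : ZMod p}
    (hc : c ≠ 0) (P : G → Prop) [DecidablePred P] : #{α : ZMod p → G | P (walkProd α c p)} =
      #{g | P g} * Fintype.card G ^ (p - 1) := by
  have h1 : #{α : ZMod p → G | P (walkProd α c p)} = #{α : ZMod p → G | P (α (-c))} := by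
    refine Finset.card_equiv (absorbWalk c hc) fun α => ?_
    simp [absorbWalk_apply_neg]
  have h2 : ({α : ZMod p → G | P (α (-c))} : Finset _) =
      Fintype.piFinset fun y => if y = -c then ({g | P g} : Finset G) else univ := by
    ext α
    simp only [Finset.mem_filter_univ, Fintype.mem_piFinset]
    constructor
    · intro h y
      split_ifs with hy <;> simp_all
    · intro h
      simpa using h (-c)
  rw [h1, h2, Fintype.card_piFinset, ← Finset.mul_prod_erase _ _ (Finset.mem_univ (-c))]
  congr 1
  · simp
  · rw [Finset.prod_congr rfl (g := fun _ => Fintype.card G)]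
    · simp [ZMod.card]
    · intro y hy
      simp [Finset.ne_of_mem_erase hy]

lemma card_forall_mem {ι G : Type*} [Fintype ι] [DecidableEq ι] [Fintype G] (P : G → Prop)
    [DecidablePred P] :
    #{α : ι → G | ∀ y, P (α y)} = #{g | P g} ^ Fintype.card ι := by
  rw [← Finset.card_univ (α := ι), ← Finset.prod_const, ← Fintype.card_piFinset]
  congr 1
  ext α
  simp

/-- The effect on the proportion of non-derangements of forming the wreath product with a cyclic
group of prime order in the power action. -/
lemma propFix_powerSubgroup_translations [Finite X] [Nontrivial X] (A : Subgroup (Perm X)) :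
    1 - propFix (powerSubgroup A (translations (ZMod p)) : Set (Perm (ZMod p → X))) 0 =
      (1 - propFix (A : Set (Perm X)) 0) *
        (p - 1 + (1 - propFix (A : Set (Perm X)) 0) ^ (p - 1)) / p := by
  classical
  cases nonempty_fintype X
  let f : (ZMod p → A) × ZMod p → Perm (ZMod p → X) :=
    fun q => powerPerm (fun y => (q.1 y : Perm X)) (Equiv.addRight q.2)
  have hf : Function.Injective f := by
    rintro ⟨α, c⟩ ⟨β, d⟩ h
    have := powerPerm_injective (a₁ := (fun y => (α y : Perm X), Equiv.addRight c))
      (a₂ := (fun y => (β y : Perm X), Equiv.addRight d)) h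
    obtain ⟨h1, h2⟩ := Prod.mk.inj this
    refine Prod.ext (funext fun y => Subtype.ext (congrFun h1 y)) ?_
    simpa using DFunLike.congr_fun h2 0
  have hrange : (powerSubgroup A (translations (ZMod p)) : Set (Perm (ZMod p → X))) =
      f '' Set.univ := by
    ext g
    constructor
    · rintro ⟨α, _, hα, ⟨c, rfl⟩, rfl⟩
      exact ⟨(fun y => ⟨α y, hα y⟩, c), trivial, rfl⟩
    · rintro ⟨⟨α, c⟩, -, rfl⟩
      exact powerPerm_mem_powerSubgroup (fun y => (α y).2) ⟨c, rfl⟩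
  have hA : (A : Set (Perm X)) = (Subtype.val : A → Perm X) '' Set.univ := by simp
  rw [hrange, propFix_image hf.injOn, propFixVia_univ_zero, hA,
    propFix_image Subtype.val_injective.injOn, propFixVia_univ_zero]
  set F : ℕ := #{a : A | ∃ x, (a : Perm X) x = x} with hF
  have hcard : #{q | ∃ ω, f q ω = ω} = F ^ p + (p - 1) * (F * Fintype.card A ^ (p - 1)) := by
    have h0 : #{α | ∃ ω, f (α, 0) ω = ω} = F ^ p := by
      have := card_forall_mem (ι := ZMod p) (fun a : A => ∃ x, (a : Perm X) x = x)
      rw [ZMod.card] at this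
      rw [hF, ← this]
      congr 1
      ext α
      simp only [f, Finset.mem_filter_univ, powerPerm_fixed_iff]
      simp [eq_comm, Classical.skolem]
    have h1 : ∀ c ∈ Finset.univ.erase (0 : ZMod p), #{α | ∃ ω, f (α, c) ω = ω} =
        F * Fintype.card A ^ (p - 1) := by
      intro c hc
      rw [hF,
        ← card_walkProd_mem (Finset.ne_of_mem_erase hc) fun a : A => ∃ x, (a : Perm X) x = x]
      congr 1
      ext α
      simp only [f, Finset.mem_filter_univ,
        exists_powerPerm_fixed_iff A α (Finset.ne_of_mem_erase hc)]
    have hsum : #{q | ∃ ω, f q ω = ω} = ∑ c, #{α | ∃ ω, f (α, c) ω = ω} := by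
      simp only [Finset.card_filter, Fintype.sum_prod_type_right]
    rw [hsum, ← Finset.add_sum_erase _ _ (Finset.mem_univ 0), h0, Finset.sum_congr rfl h1]
    simp [ZMod.card]
  have hp : p - 1 + 1 = p := Nat.sub_add_cancel (Fact.out : p.Prime).one_le
  have hp0 : (p : ℝ) ≠ 0 := by exact_mod_cast (Fact.out : p.Prime).ne_zero
  have hpc : ((p - 1 : ℕ) : ℝ) = p - 1 := by
    rw [Nat.cast_sub (Fact.out : p.Prime).one_le, Nat.cast_one]
  have hG : (Fintype.card A : ℝ) ≠ 0 := by exact_mod_cast Fintype.card_ne_zero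
  rw [hcard, Fintype.card_prod, Fintype.card_fun, ZMod.card]
  generalize Fintype.card A = N at *
  have hN : N ^ p = N ^ (p - 1) * N := by rw [← pow_succ, hp]
  have hFp : F ^ p = F ^ (p - 1) * F := by rw [← pow_succ, hp]
  rw [hN, hFp]
  push_cast [hpc]
  simp only [sub_sub_cancel, div_pow]
  field_simp
  ring

end CyclicPower

section Affine

variable (p : ℕ) [Fact p.Prime]

/-- The group of affine transformations `x ↦ a * x + b` of the prime field. -/
def affineSubgroup : Subgroup (Perm (ZMod p)) where
  carrier := Set.range fun q : (ZMod p)ˣ × ZMod p => q.1.mulLeft.trans (Equiv.addRight q.2)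
  one_mem' := ⟨(1, 0), by ext; simp⟩
  mul_mem' := by
    rintro _ _ ⟨⟨a, b⟩, rfl⟩ ⟨⟨c, d⟩, rfl⟩
    exact ⟨(a * c, a * d + b), Equiv.ext fun x => by simp; ring⟩
  inv_mem' := by
    rintro _ ⟨⟨a, b⟩, rfl⟩
    refine ⟨(a⁻¹, -(a⁻¹ * b)), Equiv.ext fun x => ?_⟩
    rw [Perm.eq_inv_iff_eq]
    simp only [Equiv.trans_apply, Units.mulLeft_apply, Equiv.coe_addRight, mul_add, mul_neg,
      Units.mul_inv_cancel_left]
    ring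

variable {p}

lemma exists_mem_affineSubgroup {a : ZMod p} (ha : a ≠ 0) (b : ZMod p) :
    ∃ g ∈ affineSubgroup p, ∀ x, g x = a * x + b :=
  ⟨_, ⟨(Units.mk0 a ha, b), rfl⟩, fun x => by simp⟩

lemma isPrimitiveSubgroup_affineSubgroup : IsPrimitiveSubgroup (affineSubgroup p) := by
  constructor
  · rw [isPretransitive_subgroup_iff]
    intro x y
    obtain ⟨g, hg, h⟩ := exists_mem_affineSubgroup (one_ne_zero (α := ZMod p)) (y - x)
    exact ⟨g, hg, by rw [h]; ring⟩
  · intro s hs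
    rw [isBlock_subgroup_iff] at hs
    rw [or_iff_not_imp_left, Set.not_subsingleton_iff]
    rintro ⟨x, hx, y, hy, hxy⟩
    refine Set.eq_univ_of_forall fun z => ?_
    rcases eq_or_ne z x with rfl | hz
    · exact hx
    have hyx : y - x ≠ 0 := sub_ne_zero.mpr hxy.symm
    have ha : (z - x) / (y - x) ≠ 0 := div_ne_zero (sub_ne_zero.mpr hz) hyx
    obtain ⟨g, hg, h⟩ := exists_mem_affineSubgroup ha (x - (z - x) / (y - x) * x)
    have hgx : g x = x := by rw [h]; ring
    have hgy : g y = z := by rw [h]; field_simp; ring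
    exact hgy ▸ hs g hg x hx (hgx.symm ▸ hx) y hy

lemma stabilizersSeparate_affineSubgroup (hp : p ≠ 2) : StabilizersSeparate (affineSubgroup p) := by
  intro x x' hne
  have h2 : (2 : ZMod p) ≠ 0 := by
    intro h
    have : ((2 : ℕ) : ZMod p) = 0 := by exact_mod_cast h
    rw [ZMod.natCast_eq_zero_iff] at this
    exact hp ((Nat.prime_dvd_prime_iff_eq Fact.out Nat.prime_two).mp this)
  obtain ⟨g, hg, h⟩ := exists_mem_affineSubgroup h2 (-x)
  refine ⟨g, hg, by rw [h]; ring, fun hfix => hne ?_⟩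
  rw [h] at hfix
  linear_combination -hfix

lemma propFix_affineSubgroup : propFix (affineSubgroup p : Set (Perm (ZMod p))) 0 = 1 / p := by
  let f : (ZMod p)ˣ × ZMod p → Perm (ZMod p) := fun q => q.1.mulLeft.trans (Equiv.addRight q.2)
  have hf : Function.Injective f := by
    rintro ⟨a, b⟩ ⟨c, d⟩ h
    have happ : ∀ x : ZMod p, a * x + b = c * x + d := fun x => by
      simpa [f] using DFunLike.congr_fun h x
    have hbd : b = d := by simpa using happ 0
    exact Prod.ext (Units.ext (by simpa [hbd] using happ 1)) hbd
  have hrange : (affineSubgroup p : Set (Perm (ZMod p))) = f '' Set.univ := by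
    rw [Set.image_univ]
    rfl
  have hder : {q ∈ (Set.univ : Set ((ZMod p)ˣ × ZMod p)) | fixCnt (f q) = 0} =
      (({1} ×ˢ Finset.univ.erase 0 : Finset ((ZMod p)ˣ × ZMod p)) : Set _) := by
    ext ⟨a, b⟩
    simp only [fixCnt_eq_zero_iff, Set.mem_ofPred_eq, Set.mem_univ, true_and, Finset.coe_product,
      Finset.coe_singleton, Set.mem_prod, Set.mem_singleton_iff, Finset.mem_coe, Finset.mem_erase,
      Finset.mem_univ, and_true]
    have hfx : ∀ x, f (a, b) x = a * x + b := fun x => by simp [f]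
    simp only [hfx]
    constructor
    · intro h
      have ha : a = 1 := by
        by_contra ha
        have ha' : (1 : ZMod p) - a ≠ 0 := fun h => ha (Units.ext (sub_eq_zero.mp h).symm)
        refine h (b / (1 - a)) ?_
        field_simp
        ring
      exact ⟨ha, fun hb => h 0 (by simp [hb])⟩
    · rintro ⟨rfl, hb⟩ x hx
      exact hb (by simpa using hx)
  have hp1 : (p : ℝ) - 1 ≠ 0 := by
    rw [sub_ne_zero]
    exact_mod_cast (Fact.out : p.Prime).one_lt.ne'
  have hp0 : (p : ℝ) ≠ 0 := by exact_mod_cast (Fact.out : p.Prime).ne_zero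
  rw [hrange, propFix_image hf.injOn, propFixVia, hder, Set.ncard_coe_finset, Set.ncard_univ,
    Nat.card_eq_fintype_card, Fintype.card_prod, ZMod.card_units, ZMod.card,
    Finset.card_product, Finset.card_singleton, Finset.card_erase_of_mem (Finset.mem_univ _),
    Finset.card_univ, ZMod.card]
  push_cast [Nat.cast_sub (Fact.out : p.Prime).one_le]
  field_simp

end Affine

section Density

/-- The derangement proportions of the primitive groups whose point stabilizers fix no further
point. -/
def IsSeparatedPrimitiveDelta (t : ℝ) : Prop :=
  ∃ (X : Type) (_ : Finite X) (_ : Nontrivial X) (A : Subgroup (Perm X)),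
    IsPrimitiveSubgroup A ∧ StabilizersSeparate A ∧ propFix (A : Set (Perm X)) 0 = t

lemma IsSeparatedPrimitiveDelta.exists_fin {t : ℝ} (h : IsSeparatedPrimitiveDelta t) :
    ∃ (m : ℕ) (A : Subgroup (Perm (Fin m))),
      1 ≤ m ∧ IsPrimitiveSubgroup A ∧ propFix (A : Set (Perm (Fin m))) 0 = t := by
  obtain ⟨X, _, _, A, hprim, -, rfl⟩ := h
  exact ⟨Nat.card X, _, Nat.card_pos, hprim.map_permCongr (Finite.equivFin X),
    propFix_map_permCongr _ A 0⟩

lemma isSeparatedPrimitiveDelta_one_div {p : ℕ} (hp : p.Prime) (hp2 : p ≠ 2) :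
    IsSeparatedPrimitiveDelta (1 / p) := by
  have : Fact p.Prime := ⟨hp⟩
  exact ⟨ZMod p, inferInstance, inferInstance, affineSubgroup p,
    isPrimitiveSubgroup_affineSubgroup, stabilizersSeparate_affineSubgroup hp2,
    propFix_affineSubgroup⟩

lemma IsSeparatedPrimitiveDelta.cyclic_power {u : ℝ} (h : IsSeparatedPrimitiveDelta (1 - u))
    {p : ℕ} (hp : p.Prime) :
    IsSeparatedPrimitiveDelta (1 - u * (p - 1 + u ^ (p - 1)) / p) := by
  have : Fact p.Prime := ⟨hp⟩
  obtain ⟨X, _, _, A, hprim, hsep, hu⟩ := h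
  refine ⟨ZMod p → X, inferInstance, inferInstance, powerSubgroup A (translations (ZMod p)),
    hprim.powerSubgroup hsep (isPretransitive_translations _), hsep.powerSubgroup _, ?_⟩
  have := propFix_powerSubgroup_translations (p := p) A
  rw [hu, sub_sub_cancel] at this
  linarith

lemma exists_isSeparatedPrimitiveDelta_near {t : ℝ} (ht : t ∈ Set.Icc (0 : ℝ) 1) {ε : ℝ}
    (hε : 0 < ε) : ∃ t', IsSeparatedPrimitiveDelta t' ∧ |t' - t| < ε := by
  obtain ⟨N, hN⟩ := exists_nat_one_div_lt hε
  obtain ⟨p, hpN, hp⟩ := Nat.exists_infinite_primes (N + 3)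
  have hp3 : (3 : ℝ) ≤ p := by exact_mod_cast (by omega : 3 ≤ p)
  have hpε : 1 / (p : ℝ) < ε := by
    refine lt_of_le_of_lt (one_div_le_one_div_of_le (by positivity) ?_) hN
    exact_mod_cast (by omega : N + 1 ≤ p)
  have hpinv : 0 < 1 / (p : ℝ) ∧ 1 / (p : ℝ) ≤ 1 / 3 :=
    ⟨by positivity, one_div_le_one_div_of_le (by norm_num) hp3⟩
  let g : ℝ → ℝ := fun u => u * (p - 1 + u ^ (p - 1)) / p
  let u : ℕ → ℝ := fun k => g^[k] (1 - 1 / p)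
  have hstep : ∀ k, u (k + 1) = u k * (p - 1 + u k ^ (p - 1)) / p :=
    fun k => Function.iterate_succ_apply' g k _
  have hreal : ∀ k, IsSeparatedPrimitiveDelta (1 - u k) := by
    intro k
    induction k with
    | zero => simpa [u] using isSeparatedPrimitiveDelta_one_div hp (by omega)
    | succ k ih => rw [hstep]; exact ih.cyclic_power hp
  let r : ℝ := (p - 1 + (1 - 1 / p : ℝ) ^ (p - 1)) / p
  have hpow : (1 - 1 / p : ℝ) ^ (p - 1) < 1 :=
    pow_lt_one₀ (by linarith) (by linarith) (by omega)
  have hr0 : 0 ≤ r := by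
    have : 0 ≤ (1 - 1 / p : ℝ) ^ (p - 1) := pow_nonneg (by linarith) _
    exact div_nonneg (by linarith) (by linarith)
  have hr1 : r < 1 := by
    rw [div_lt_one (by linarith)]
    linarith
  have hbound : ∀ k, 0 ≤ u k ∧ u k ≤ 1 - 1 / p ∧ u k ≤ r ^ k := by
    intro k
    induction k with
    | zero => exact ⟨by simp only [u, Function.iterate_zero, id]; linarith, le_rfl, by
        simp only [u, Function.iterate_zero, id, pow_zero]; linarith⟩
    | succ k ih =>
      obtain ⟨h0, h1, h2⟩ := ih
      have hle : u (k + 1) ≤ r * u k := by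
        rw [hstep, mul_comm r, mul_div_assoc]
        refine mul_le_mul_of_nonneg_left ?_ h0
        simp only [r]
        gcongr
      have hpk : 0 ≤ u k ^ (p - 1) := pow_nonneg h0 _
      refine ⟨?_, ?_, ?_⟩
      · rw [hstep]
        exact div_nonneg (mul_nonneg h0 (by linarith)) (by linarith)
      · exact hle.trans ((mul_le_of_le_one_left h0 hr1.le).trans h1)
      · rw [pow_succ']
        exact hle.trans (mul_le_mul_of_nonneg_left h2 hr0)
  have hdrop : ∀ k, u k - 1 / p ≤ u (k + 1) := by
    intro k
    obtain ⟨h0, h1, -⟩ := hbound k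
    have hpk : 0 ≤ u k * u k ^ (p - 1) := mul_nonneg h0 (pow_nonneg h0 _)
    rw [hstep, le_div_iff₀ (by linarith), sub_mul, one_div_mul_cancel (by linarith)]
    linarith
  have hex : ∃ k, u k < 1 - t + ε := by
    obtain ⟨k, hk⟩ := exists_pow_lt_of_lt_one hε hr1
    exact ⟨k, by linarith [(hbound k).2.2, ht.2]⟩
  classical
  refine ⟨_, hreal (Nat.find hex), ?_⟩
  have hlt := Nat.find_spec hex
  have hge : 1 - t - ε < u (Nat.find hex) := by
    rcases Nat.eq_zero_or_eq_succ_pred (Nat.find hex) with h | h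
    · rw [h]
      simp only [u, Function.iterate_zero, id]
      linarith [ht.1]
    · have hmin := Nat.find_min hex (m := (Nat.find hex).pred) (by omega)
      have := hdrop (Nat.find hex).pred
      rw [← Nat.succ_eq_add_one, ← h] at this
      linarith
  rw [abs_lt]
  constructor <;> linarith

end Density

section ImprimitiveWreath

lemma ncard_prod_pi {ι G H : Type*} [Fintype ι] [Fintype G] [Fintype H]
    (T : Finset H) (S : H → ι → Finset G) :
    {q : (ι → G) × H | q.2 ∈ T ∧ ∀ y, q.1 y ∈ S q.2 y}.ncard = ∑ b ∈ T, ∏ y, #(S b y) := by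
  classical
  have h : {q : (ι → G) × H | q.2 ∈ T ∧ ∀ y, q.1 y ∈ S q.2 y} =
      ((Finset.univ.filter fun q : (ι → G) × H => q.2 ∈ T ∧ ∀ y, q.1 y ∈ S q.2 y) : Set _) := by
    simp
  rw [h, Set.ncard_coe_finset, Finset.card_filter, Fintype.sum_prod_type_right,
    ← Finset.sum_filter_add_sum_filter_not Finset.univ (· ∈ T),
    Finset.sum_eq_zero (s := {b | b ∉ T}), add_zero]
  · refine Finset.sum_congr (by simp) fun b hb => ?_
    have hb' : b ∈ T := by simpa using hb
    rw [← Fintype.card_piFinset, ← Finset.card_filter]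
    congr 1
    ext α
    simp [hb']
  · intro b hb
    have hb' : b ∉ T := by simpa using hb
    simp [hb']

lemma imprimPerm_fixCnt_eq_zero_iff {X Y : Type*} [Finite X] [Finite Y] (α : Y → Perm X)
    (b : Perm Y) : fixCnt (imprimPerm α b) = 0 ↔ ∀ y, b y = y → fixCnt (α y) = 0 := by
  simp only [fixCnt_eq_zero_iff, Prod.forall, imprimPerm, Equiv.coe_fn_mk, ne_eq, Prod.mk.injEq,
    not_and]
  exact ⟨fun h y hy x hx => h x y hx hy, fun h x y hx hy => h y hy x hx⟩

lemma fixCnt_eq_card_filter {Y : Type*} [Fintype Y] [DecidableEq Y] (b : Perm Y) :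
    fixCnt b = #{y | b y = y} := by
  rw [fixCnt, ← Set.ncard_coe_finset]
  simp

/-- The proportion of derangements in an imprimitive wreath product is the average of
`δ(A) ^ fix(b)` over `b ∈ B`. -/
lemma deltaI_zero_eq {m n : ℕ} (A : Subgroup (Perm (Fin m))) (B : Subgroup (Perm (Fin n)))
    [DecidablePred (· ∈ B)] : deltaI A B 0 = (∑ b : Perm (Fin n) with b ∈ B,
      propFix (A : Set (Perm (Fin m))) 0 ^ fixCnt b) / #{b : Perm (Fin n) | b ∈ B} := by
  classical
  set T : Finset (Perm (Fin n)) := {b | b ∈ B} with hT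
  set S : Finset (Perm (Fin m)) := {a | a ∈ A} with hS
  set D : Finset (Perm (Fin m)) := {a | a ∈ A ∧ fixCnt a = 0} with hD
  have hS0 : (#S : ℝ) ≠ 0 := by
    exact_mod_cast Finset.card_ne_zero_of_mem (a := 1) (by simp [hS, A.one_mem])
  have hδ : propFix (A : Set (Perm (Fin m))) 0 = #D / #S := by
    rw [propFix, propFixVia, ← Set.ncard_coe_finset, ← Set.ncard_coe_finset]
    simp [hD, hS]
  have hwreath : (wreathSet A B).ncard = #T * #S ^ n := by
    have := ncard_prod_pi T fun _ (_ : Fin n) => S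
    simp only [Finset.prod_const, Finset.sum_const, Finset.card_univ, Fintype.card_fin,
      smul_eq_mul] at this
    rw [← this]
    congr 1
    ext q
    simp [wreathSet, hT, hS, and_comm]
  have hder : {q ∈ wreathSet A B | fixCnt (imprimPerm q.1 q.2) = 0}.ncard =
      ∑ b ∈ T, ∏ y, #(if b y = y then D else S) := by
    rw [← ncard_prod_pi T fun b y => if b y = y then D else S]
    congr 1
    ext ⟨α, b⟩
    simp only [wreathSet, imprimPerm_fixCnt_eq_zero_iff, Set.mem_ofPred_eq, hT,
      Finset.mem_filter_univ]
    constructor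
    · rintro ⟨⟨hα, hb⟩, h⟩
      refine ⟨hb, fun y => ?_⟩
      split_ifs with hy
      · simp [hD, hα, h y hy]
      · simp [hS, hα]
    · rintro ⟨hb, h⟩
      refine ⟨⟨fun y => ?_, hb⟩, fun y hy => ?_⟩
      · have := h y
        split_ifs at this
        · exact (by simpa [hD] using this : _ ∧ _).1
        · simpa [hS] using this
      · have := h y
        rw [if_pos hy] at this
        exact (by simpa [hD] using this : _ ∧ _).2
  rw [deltaI, propFixVia, hder, hwreath, hδ]
  push_cast
  rw [mul_comm, ← div_div, Finset.sum_div]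
  congr 1
  refine Finset.sum_congr rfl fun b _ => ?_
  have hn : (#S : ℝ) ^ n = ∏ _y : Fin n, (#S : ℝ) := by simp
  rw [hn, ← Finset.prod_div_distrib, fixCnt_eq_card_filter, ← Finset.prod_const,
    Finset.prod_filter]
  refine Finset.prod_congr rfl fun y _ => ?_
  split_ifs
  · rfl
  · exact div_self hS0

lemma propFix_zero_eq_sum {Y : Type*} [Fintype Y] [DecidableEq Y] (B : Subgroup (Perm Y))
    [DecidablePred (· ∈ B)] :
    propFix (B : Set (Perm Y)) 0 =
      (∑ b : Perm Y with b ∈ B, (0 : ℝ) ^ fixCnt b) / #{b : Perm Y | b ∈ B} := by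
  have h1 : {b ∈ (B : Set (Perm Y)) | fixCnt (id b) = 0}.ncard =
      #{b : Perm Y | b ∈ B ∧ fixCnt b = 0} := by
    rw [← Set.ncard_coe_finset]
    simp
  have h2 : (B : Set (Perm Y)).ncard = #{b : Perm Y | b ∈ B} := by
    rw [← Set.ncard_coe_finset]
    congr 1
    ext
    simp
  rw [propFix, propFixVia, h1, h2]
  simp [zero_pow_eq, Finset.filter_filter]

end ImprimitiveWreath

/-- **Theorem (density for imprimitive wreath products, varying primitive `A`).**
For fixed `B ≤ S_n`, the set `{δ(A ≀_I B) : A ≤ S_m primitive, m ∈ ℕ}`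
is dense in `[δ(B), 1]`. -/
theorem dense_delta_imprimitive_wreath_primitive_A (n : ℕ) (hn : 1 ≤ n)
    (B : Subgroup (Equiv.Perm (Fin n))) :
    {x : ℝ | ∃ (m : ℕ) (A : Subgroup (Equiv.Perm (Fin m))),
        1 ≤ m ∧ IsPrimitiveSubgroup A ∧ x = deltaI A B 0} ⊆
      Set.Icc (propFix (B : Set (Equiv.Perm (Fin n))) 0) 1 ∧
    Set.Icc (propFix (B : Set (Equiv.Perm (Fin n))) 0) 1 ⊆
      closure {x : ℝ | ∃ (m : ℕ) (A : Subgroup (Equiv.Perm (Fin m))),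
        1 ≤ m ∧ IsPrimitiveSubgroup A ∧ x = deltaI A B 0} := by
  classical
  set T : Finset (Perm (Fin n)) := {b | b ∈ B} with hT
  have hT0 : (0 : ℝ) < #T := by
    exact_mod_cast Finset.card_pos.mpr ⟨1, by simp [hT, B.one_mem]⟩
  let f : ℝ → ℝ := fun t => (∑ b ∈ T, t ^ fixCnt b) / #T
  have hf0 : propFix (B : Set (Perm (Fin n))) 0 = f 0 := propFix_zero_eq_sum B
  have hf1 : f 1 = 1 := by simp [f, hT0.ne']
  have hfA : ∀ {m : ℕ} (A : Subgroup (Perm (Fin m))),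
      deltaI A B 0 = f (propFix (A : Set (Perm (Fin m))) 0) := fun A => deltaI_zero_eq A B
  have hcont : Continuous f := by fun_prop
  have hmono : MonotoneOn f (Set.Ici 0) := by
    intro s hs t _ hst
    have hs0 : (0 : ℝ) ≤ s := hs
    simp only [f]
    gcongr
  rw [hf0]
  constructor
  · rintro _ ⟨m, A, -, -, rfl⟩
    obtain ⟨h0, h1⟩ := propFixVia_mem_Icc id (A : Set (Perm (Fin m))) 0
    rw [hfA]
    refine ⟨hmono Set.self_mem_Ici h0 h0, ?_⟩
    rw [← hf1]
    exact hmono h0 (Set.mem_Ici.mpr zero_le_one) h1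
  · nth_rewrite 1 [← hf1]
    refine (intermediate_value_Icc zero_le_one hcont.continuousOn).trans ?_
    rintro _ ⟨t, ht, rfl⟩
    have htc : t ∈ closure {t | IsSeparatedPrimitiveDelta t} := by
      refine Metric.mem_closure_iff.mpr fun ε hε => ?_
      obtain ⟨t', ht', hdist⟩ := exists_isSeparatedPrimitiveDelta_near ht hε
      exact ⟨t', ht', by rwa [dist_comm, Real.dist_eq]⟩
    refine closure_mono ?_ (image_closure_subset_closure_image hcont ⟨t, htc, rfl⟩)
    rintro _ ⟨t', ht', rfl⟩
    obtain ⟨m, A, hm, hA, rfl⟩ := IsSeparatedPrimitiveDelta.exists_fin ht'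
    exact ⟨m, A, hm, hA, (hfA A).symm⟩
end
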